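/- Let g : ℝ → ℂ be measurable with compact support and ∫_ℝ |g(t)| (1 + log⁺|g(t)|) dt < ∞, and let Ω = {x + iy : a < x < a + ℓ, 0 < y < ℓ} (a ∈ ℝ, ℓ > 0) be an open square in the upper half-plane one side of which is a segment of ℝ. Then the Cauchy transform 𝒞g satisfies ∫_Ω |(𝒞g)(z)|² dA(z) < ∞, i.e., 𝒞g ∈ A²(Ω). -/

import Mathlib

open MeasureTheory Set

noncomputable section

/-- The open sector `Δ = {z : |arg z| < π/4}`. -/
def SectorDelta : Set ℂ := {z : ℂ | 0 < z.re ∧ |z.im| < z.re}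

/-- The reflected sector `π − Δ`. -/
def SectorPiDelta : Set ℂ := (fun z => (Real.pi : ℂ) - z) '' SectorDelta

/-- The open square `D = Δ ∩ (π − Δ)` with vertices `0, π/2 − iπ/2, π, π/2 + iπ/2`. -/
def SquareD : Set ℂ := SectorDelta ∩ SectorPiDelta

/-- Membership in the Bergman space `A²(Ω)`. -/
def MemA2 (Ω : Set ℂ) (f : ℂ → ℂ) : Prop :=
  DifferentiableOn ℂ f Ω ∧ ∫⁻ z in Ω, ENNReal.ofReal (‖f z‖ ^ 2) < ⊤

/-- Membership in the weighted Bergman space `A²(Ω, w)`. -/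
def MemA2W (Ω : Set ℂ) (w : ℂ → ℝ) (f : ℂ → ℂ) : Prop :=
  DifferentiableOn ℂ f Ω ∧ ∫⁻ z in Ω, ENNReal.ofReal (‖f z‖ ^ 2 * w z) < ⊤

/-- `log⁺ t = max (log t) 0`. -/
def logPlus (t : ℝ) : ℝ := Real.log (max t 1)

/-- Starting vertices of the four sides of `∂D`, counterclockwise. -/
def sideStart : Fin 4 → ℂ
  | 0 => 0
  | 1 => ((Real.pi / 2 : ℝ) : ℂ) * (1 - Complex.I)
  | 2 => ((Real.pi : ℝ) : ℂ)
  | 3 => ((Real.pi / 2 : ℝ) : ℂ) * (1 + Complex.I)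

/-- Direction vectors of the four sides of `∂D`, counterclockwise. -/
def sideDir : Fin 4 → ℂ
  | 0 => ((Real.pi / 2 : ℝ) : ℂ) * (1 - Complex.I)
  | 1 => ((Real.pi / 2 : ℝ) : ℂ) * (1 + Complex.I)
  | 2 => ((Real.pi / 2 : ℝ) : ℂ) * (Complex.I - 1)
  | 3 => -(((Real.pi / 2 : ℝ) : ℂ) * (1 + Complex.I))

/-- Parametrization of the `k`-th side of `∂D`. -/
def sidePath (k : Fin 4) (t : ℝ) : ℂ := sideStart k + (t : ℂ) * sideDir k

/-- `g` is arclength-integrable on `∂D` (each side has constant speed). -/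
def BoundaryIntegrable (g : ℂ → ℂ) : Prop :=
  ∀ k : Fin 4, IntervalIntegrable (fun t => ‖g (sidePath k t)‖) volume 0 1

/-- `∫_{∂D} |g| log⁺|g| |du| < ∞` (each side has constant speed). -/
def BoundaryLlogL (g : ℂ → ℂ) : Prop :=
  ∀ k : Fin 4, IntervalIntegrable
    (fun t => ‖g (sidePath k t)‖ * logPlus ‖g (sidePath k t)‖) volume 0 1

/-- The Cauchy integral `(1/(2πi)) ∮_{∂D} g(u)/(u − z) du`, `∂D` counterclockwise. -/
def cauchyD (g : ℂ → ℂ) (z : ℂ) : ℂ :=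
  (2 * (Real.pi : ℂ) * Complex.I)⁻¹ *
    ∑ k : Fin 4, ∫ t in (0:ℝ)..1, g (sidePath k t) * sideDir k / (sidePath k t - z)

/-- The Cauchy transform `(𝒞g)(z) = (1/(iπ)) ∫_ℝ g(t)/(t − z) dt` on the upper half-plane. -/
def cauchyTransform (g : ℝ → ℂ) (z : ℂ) : ℂ :=
  (Complex.I * (Real.pi : ℂ))⁻¹ * ∫ t : ℝ, g t / ((t : ℂ) - z)

def radF (R δ r : ℝ) : ℝ := if r ≤ R then 1 / (r * max r δ) else 0

lemma radF_meas (R δ : ℝ) : Measurable (radF R δ) := by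
  unfold radF
  exact Measurable.ite measurableSet_Iic (by fun_prop) measurable_const

lemma lintegral_inv_Ioc (δ R : ℝ) (hδ : 0 < δ) (h : δ ≤ R) :
    ∫⁻ r in Ioc δ R, ENNReal.ofReal (1 / r) = ENNReal.ofReal (Real.log (R / δ)) := by
  have hi : IntervalIntegrable (fun r : ℝ => 1 / r) volume δ R := by
    apply ContinuousOn.intervalIntegrable
    intro x hx
    rw [uIcc_of_le h] at hx
    have : x ≠ 0 := by linarith [hx.1]
    exact (continuousAt_const.div continuousAt_id this).continuousWithinAt
  rw [← ofReal_integral_eq_lintegral_ofReal]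
  · rw [← intervalIntegral.integral_of_le h, integral_one_div_of_pos hδ (by linarith)]
  · exact (intervalIntegrable_iff_integrableOn_Ioc_of_le h).1 hi
  · filter_upwards [ae_restrict_mem measurableSet_Ioc] with r hr
    have : 0 < r := by linarith [hr.1]
    simp only [Pi.zero_apply]; positivity

lemma radial_bound (R δ : ℝ) (hδ : 0 < δ) (h : δ ≤ R) :
    ∫⁻ z : ℂ, ENNReal.ofReal (radF R δ ‖z‖) ≤
      ENNReal.ofReal (2 * Real.pi) * ENNReal.ofReal (1 + Real.log (R / δ)) := by
  rw [← Complex.lintegral_comp_polarCoord_symm]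
  let H : ℝ → ENNReal := fun r => (Ioc 0 δ).indicator (fun _ => ENNReal.ofReal (1/δ)) r
    + (Ioc δ R).indicator (fun r => ENNReal.ofReal (1/r)) r
  have hH : Measurable H := by
    refine (measurable_const.indicator measurableSet_Ioc).add
      (Measurable.indicator (by fun_prop) measurableSet_Ioc)
  have h1 : ∫⁻ p in polarCoord.target, ENNReal.ofReal p.1 •
      ENNReal.ofReal (radF R δ ‖Complex.polarCoord.symm p‖) ≤
      ∫⁻ p in polarCoord.target, H p.1 := by
    refine setLIntegral_mono (by fun_prop) ?_
    intro p hp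
    have hp1 : 0 < p.1 := hp.1
    rw [Complex.norm_polarCoord_symm, abs_of_pos hp1, smul_eq_mul, ← ENNReal.ofReal_mul hp1.le]
    simp only [H, radF]
    by_cases hR : p.1 ≤ R
    · rw [if_pos hR]
      have e : p.1 * (1 / (p.1 * max p.1 δ)) = 1 / max p.1 δ := by
        field_simp
      rw [e]
      by_cases hd : p.1 ≤ δ
      · rw [indicator_of_mem (show p.1 ∈ Ioc 0 δ from ⟨hp1, hd⟩), max_eq_right hd]
        exact le_self_add
      · push Not at hd
        rw [indicator_of_mem (show p.1 ∈ Ioc δ R from ⟨hd, hR⟩), max_eq_left hd.le]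
        exact le_add_self
    · rw [if_neg hR]; simp
  refine h1.trans ?_
  have h2 : ∫⁻ p in polarCoord.target, H p.1 =
      (∫⁻ r in Ioi 0, H r) * ENNReal.ofReal (2 * Real.pi) := by
    rw [polarCoord_target, Measure.volume_eq_prod, ← Measure.prod_restrict,
      lintegral_prod _ (by fun_prop)]
    simp only [lintegral_const, Measure.restrict_apply MeasurableSet.univ, univ_inter,
      Real.volume_Ioo]
    rw [lintegral_mul_const _ hH]
    congr 2; ring
  rw [h2, mul_comm]
  gcongr
  calc ∫⁻ r in Ioi 0, H r ≤ ∫⁻ r, H r := setLIntegral_le_lintegral _ _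
    _ = ENNReal.ofReal 1 + ENNReal.ofReal (Real.log (R / δ)) := by
      simp only [H]
      rw [lintegral_add_left (measurable_const.indicator measurableSet_Ioc),
        lintegral_indicator measurableSet_Ioc, lintegral_indicator measurableSet_Ioc,
        lintegral_inv_Ioc δ R hδ h]
      congr 1
      simp only [lintegral_const, Measure.restrict_apply MeasurableSet.univ, univ_inter,
        Real.volume_Ioc]
      rw [← ENNReal.ofReal_mul (by positivity)]
      congr 1; field_simp; ring
    _ = _ := by
      rw [ENNReal.ofReal_add zero_le_one]
      exact Real.log_nonneg (by rw [le_div_iff₀ hδ]; linarith)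

lemma kernel_pt (R : ℝ) (t s : ℝ) (z : ℂ) (hz : 0 < z.im)
    (ht : ‖(t:ℂ) - z‖ ≤ R) (hs : ‖(s:ℂ) - z‖ ≤ R) (hts : t ≠ s) :
    ‖(t:ℂ) - z‖⁻¹ * ‖(s:ℂ) - z‖⁻¹ ≤
      radF R (|t - s| / 2) ‖(t:ℂ) - z‖ + radF R (|t - s| / 2) ‖(s:ℂ) - z‖ := by
  have key : ∀ u v : ℝ, 0 < v → |t - s| ≤ u + v → v ≤ u → v ≤ R →
      v⁻¹ * u⁻¹ ≤ radF R (|t-s|/2) v := by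
    intro u v hv h1 h2 h3
    rw [radF, if_pos h3, ← mul_inv, one_div]
    have : max v (|t-s|/2) ≤ u := max_le h2 (by linarith)
    have : 0 < max v (|t-s|/2) := lt_max_of_lt_left hv
    gcongr
  have pos : ∀ t : ℝ, 0 < ‖(t:ℂ) - z‖ := by
    intro t
    rw [norm_pos_iff]
    intro h
    have := congrArg Complex.im h
    simp at this
    linarith
  have nn : ∀ v, 0 ≤ v → 0 ≤ radF R (|t-s|/2) v := by
    intro v hv; unfold radF; split_ifs <;> positivity
  have tri : |t - s| ≤ ‖(t:ℂ) - z‖ + ‖(s:ℂ) - z‖ := by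
    have : ((t - s : ℝ) : ℂ) = ((t:ℂ) - z) - ((s:ℂ) - z) := by push_cast; ring
    rw [← Real.norm_eq_abs, ← Complex.norm_real, this]
    exact norm_sub_le _ _
  rcases le_total ‖(t:ℂ) - z‖ ‖(s:ℂ) - z‖ with h | h
  · have := key _ _ (pos t) (by linarith) h ht
    linarith [nn _ (norm_nonneg ((s:ℂ) - z))]
  · have := key _ _ (pos s) (by linarith) h hs
    rw [mul_comm]
    linarith [nn _ (norm_nonneg ((t:ℂ) - z))]

/-- kernel integral bound -/
lemma kernel_bound (R : ℝ) (Ω : Set ℂ) (hΩ : MeasurableSet Ω) (t s : ℝ) (h0 : ∀ z ∈ Ω, 0 < z.im)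
    (ht : ∀ z ∈ Ω, ‖(t:ℂ) - z‖ ≤ R) (hs : ∀ z ∈ Ω, ‖(s:ℂ) - z‖ ≤ R) (hts : t ≠ s)
    (hR : |t - s| / 2 ≤ R) :
    ∫⁻ z in Ω, ENNReal.ofReal (‖(t:ℂ) - z‖⁻¹ * ‖(s:ℂ) - z‖⁻¹) ≤
      ENNReal.ofReal (4 * Real.pi) * ENNReal.ofReal (1 + Real.log (R / (|t - s| / 2))) := by
  have hd : 0 < |t - s| / 2 := by have := abs_pos.2 (sub_ne_zero.2 hts); linarith
  have m := radF_meas R (|t - s| / 2)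
  set δ := |t - s| / 2 with hδ
  have tr : ∀ t : ℝ, ∫⁻ z : ℂ, ENNReal.ofReal (radF R δ ‖(t:ℂ) - z‖) =
     ∫⁻ z : ℂ, ENNReal.ofReal (radF R δ ‖z‖) := by
    intro t
    exact lintegral_sub_left_eq_self (fun z : ℂ => ENNReal.ofReal (radF R δ ‖z‖)) (t:ℂ)
  calc _ ≤ ∫⁻ z in Ω, (ENNReal.ofReal (radF R δ ‖(t:ℂ) - z‖)
          + ENNReal.ofReal (radF R δ ‖(s:ℂ) - z‖)) := by
        refine setLIntegral_mono (by fun_prop) ?_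
        intro z hz
        refine (ENNReal.ofReal_le_ofReal (kernel_pt R t s z (h0 z hz) (ht z hz) (hs z hz) hts)).trans
          ENNReal.ofReal_add_le
    _ ≤ ∫⁻ z, (ENNReal.ofReal (radF R δ ‖(t:ℂ) - z‖)
          + ENNReal.ofReal (radF R δ ‖(s:ℂ) - z‖)) := setLIntegral_le_lintegral _ _
    _ = _ := by rw [lintegral_add_left (by fun_prop), tr, tr]
    _ ≤ _ := add_le_add (radial_bound R δ hd hR) (radial_bound R δ hd hR)
    _ = _ := by
      rw [← add_mul, ← ENNReal.ofReal_add (by positivity) (by positivity)]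
      congr 2; ring

lemma young_aux (a u : ℝ) (ha : 0 ≤ a) (hu : 1 ≤ u) :
    a * (1 + Real.log u) ≤ 4 * (a * (1 + logPlus a)) + 4 * Real.sqrt u := by
  set w := Real.sqrt (Real.sqrt u) with hw
  have hs1 : 1 ≤ Real.sqrt u := by rw [Real.one_le_sqrt]; exact hu
  have hw1 : 1 ≤ w := by rw [hw, Real.one_le_sqrt]; exact hs1
  have hw2 : w ^ 2 = Real.sqrt u := Real.sq_sqrt (by positivity)
  have hw4 : u = w ^ 4 := by
    have : w ^ 4 = (w ^ 2) ^ 2 := by ring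
    rw [this, hw2, Real.sq_sqrt (by linarith)]
  have hl : Real.log u = 4 * Real.log w := by rw [hw4, Real.log_pow]; norm_num
  have hp : 0 ≤ logPlus a := Real.log_nonneg (le_max_right _ _)
  rw [← hw2, hl]
  rcases le_total w a with h | h
  · have : Real.log w ≤ logPlus a := Real.log_le_log (by linarith) (h.trans (le_max_left _ _))
    have := mul_le_mul_of_nonneg_left this ha
    nlinarith [sq_nonneg w]
  · have h1 : Real.log w ≤ w := (Real.log_le_sub_one_of_pos (by linarith)).trans (by linarith)
    have h2 : 0 ≤ Real.log w := Real.log_nonneg hw1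
    have : a * Real.log w ≤ w * w := mul_le_mul h h1 h2 (by linarith)
    nlinarith [mul_nonneg ha hp]

lemma phi_fin (R : ℝ) :
    ∫⁻ v in Icc (-(2*R)) (2*R), ENNReal.ofReal (Real.sqrt (R / (|v| / 2))) < ⊤ := by
  have : LocallyIntegrable (fun v : ℝ => Real.sqrt (R / (|v| / 2))) volume := by
    refine locallyIntegrable_of_norm_le_rpow (C := Real.sqrt (2 * R)) (α := 1/2) (by simp)
      (by simp; norm_num) ?_ (Measurable.aestronglyMeasurable (by fun_prop))
    refine Filter.Eventually.of_forall fun v => ?_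
    rw [Real.norm_of_nonneg (Real.sqrt_nonneg _), Real.rpow_neg (norm_nonneg _),
      ← Real.sqrt_eq_rpow, Real.norm_eq_abs, ← Real.sqrt_inv, ← Real.sqrt_mul' _ (by positivity)]
    apply le_of_eq; congr 1
    rw [div_div_eq_mul_div]; ring
  have h := (this.integrableOn_isCompact (isCompact_Icc (a := -(2*R)) (b := 2*R))).lintegral_lt_top
  exact h

lemma inner_bound (g : ℝ → ℂ) (hmeas : Measurable g)
    (hLlogL : ∫⁻ t : ℝ, ENNReal.ofReal (‖g t‖ * (1 + logPlus ‖g t‖)) < ⊤)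
    (R M : ℝ) (hMR : M ≤ R) (hg : ∀ t, M < |t| → g t = 0)
    (Ω : Set ℂ) (hΩ : MeasurableSet Ω) (h0 : ∀ z ∈ Ω, 0 < z.im)
    (hz : ∀ t : ℝ, |t| ≤ M → ∀ z ∈ Ω, ‖(t:ℂ) - z‖ ≤ R) :
    ∃ C : ENNReal, C < ⊤ ∧ ∀ s : ℝ, |s| ≤ M → ∫⁻ t, ENNReal.ofReal ‖g t‖ *
      (∫⁻ z in Ω, ENNReal.ofReal (‖(t:ℂ) - z‖⁻¹ * ‖(s:ℂ) - z‖⁻¹)) ≤ C := by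
  set J := ∫⁻ t : ℝ, ENNReal.ofReal (‖g t‖ * (1 + logPlus ‖g t‖)) with hJ
  set P := ∫⁻ v in Icc (-(2*R)) (2*R), ENNReal.ofReal (Real.sqrt (R / (|v| / 2))) with hP
  refine ⟨ENNReal.ofReal (4 * Real.pi) * (4 * J + 4 * P), ?_, ?_⟩
  · refine ENNReal.mul_lt_top ENNReal.ofReal_lt_top (ENNReal.add_lt_top.2 ⟨?_, ?_⟩)
    · exact ENNReal.mul_lt_top (by simp) hLlogL
    · exact ENNReal.mul_lt_top (by simp) (phi_fin R)
  intro s hs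
  let φ : ℝ → ENNReal := (Icc (-(2*R)) (2*R)).indicator
    (fun v => ENNReal.ofReal (Real.sqrt (R / (|v| / 2))))
  have hφ : Measurable φ := Measurable.indicator (by fun_prop) measurableSet_Icc
  have lpm : Measurable logPlus := by unfold logPlus; fun_prop
  have pt : ∀ᵐ t : ℝ, ENNReal.ofReal ‖g t‖ *
      (∫⁻ z in Ω, ENNReal.ofReal (‖(t:ℂ) - z‖⁻¹ * ‖(s:ℂ) - z‖⁻¹)) ≤
      ENNReal.ofReal (4 * Real.pi) *
        (4 * ENNReal.ofReal (‖g t‖ * (1 + logPlus ‖g t‖)) + 4 * φ (t - s)) := by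
    have hne : ∀ᵐ t : ℝ, t ≠ s := by simp [ae_iff]
    filter_upwards [hne] with t hts
    by_cases htM : M < |t|
    · rw [hg t htM]; simp
    push Not at htM
    have hd : 0 < |t - s| := abs_pos.2 (sub_ne_zero.2 hts)
    have hdd : |t - s| ≤ 2 * R := by
      have := abs_sub t s
      linarith
    have hmem : t - s ∈ Icc (-(2*R)) (2*R) := abs_le.1 hdd
    have hu : 1 ≤ R / (|t - s| / 2) := by rw [le_div_iff₀ (by positivity)]; linarith
    have hk := kernel_bound R Ω hΩ t s h0 (hz t htM) (hz s hs) hts (by linarith)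
    have hy := young_aux ‖g t‖ _ (norm_nonneg _) hu
    have hp : 0 ≤ logPlus ‖g t‖ := Real.log_nonneg (le_max_right _ _)
    calc _ ≤ ENNReal.ofReal ‖g t‖ * (ENNReal.ofReal (4 * Real.pi) *
            ENNReal.ofReal (1 + Real.log (R / (|t - s| / 2)))) := by gcongr
      _ = ENNReal.ofReal (4 * Real.pi) *
            ENNReal.ofReal (‖g t‖ * (1 + Real.log (R / (|t - s| / 2)))) := by
          rw [ENNReal.ofReal_mul (norm_nonneg _)]; ring
      _ ≤ _ := by
          gcongr
          refine (ENNReal.ofReal_le_ofReal hy).trans ?_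
          rw [ENNReal.ofReal_add (by positivity) (by positivity),
            ENNReal.ofReal_mul (by norm_num), ENNReal.ofReal_mul (p := 4) (by norm_num)]
          simp only [φ]
          rw [indicator_of_mem hmem]
          simp
  refine (lintegral_mono_ae pt).trans ?_
  rw [lintegral_const_mul _ (by fun_prop), lintegral_add_left (by fun_prop),
    lintegral_const_mul _ (by fun_prop), lintegral_const_mul _ (by fun_prop),
    lintegral_sub_right_eq_self φ s, lintegral_indicator measurableSet_Icc]

lemma sq_bound (g : ℝ → ℂ) (hmeas : Measurable g)
    (hLlogL : ∫⁻ t : ℝ, ENNReal.ofReal (‖g t‖ * (1 + logPlus ‖g t‖)) < ⊤)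
    (R M : ℝ) (hMR : M ≤ R) (hg : ∀ t, M < |t| → g t = 0)
    (Ω : Set ℂ) (hΩ : MeasurableSet Ω) (h0 : ∀ z ∈ Ω, 0 < z.im)
    (hz : ∀ t : ℝ, |t| ≤ M → ∀ z ∈ Ω, ‖(t:ℂ) - z‖ ≤ R)
    (hint : Integrable g) :
    ∫⁻ z in Ω, (∫⁻ t : ℝ, ENNReal.ofReal ‖g t‖ * ENNReal.ofReal ‖(t:ℂ) - z‖⁻¹) ^ 2 < ⊤ := by
  obtain ⟨C, hC, hb⟩ := inner_bound g hmeas hLlogL R M hMR hg Ω hΩ h0 hz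
  have e1 : ∀ z : ℂ, (∫⁻ t : ℝ, ENNReal.ofReal ‖g t‖ * ENNReal.ofReal ‖(t:ℂ) - z‖⁻¹) ^ 2 =
      ∫⁻ s : ℝ, ∫⁻ t : ℝ, ENNReal.ofReal ‖g s‖ * (ENNReal.ofReal ‖g t‖ *
        ENNReal.ofReal (‖(t:ℂ) - z‖⁻¹ * ‖(s:ℂ) - z‖⁻¹)) := by
    intro z
    rw [sq, ← lintegral_mul_const _ (by fun_prop)]
    refine lintegral_congr fun s => ?_
    rw [← lintegral_const_mul _ (by fun_prop)]
    refine lintegral_congr fun t => ?_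
    rw [ENNReal.ofReal_mul (by positivity)]
    ring
  simp_rw [e1]
  rw [lintegral_lintegral_swap (by
    apply Measurable.aemeasurable
    apply Measurable.lintegral_prod_right
    fun_prop)]
  have e2 : ∀ s : ℝ, ∫⁻ z in Ω, ∫⁻ t : ℝ, ENNReal.ofReal ‖g s‖ * (ENNReal.ofReal ‖g t‖ *
        ENNReal.ofReal (‖(t:ℂ) - z‖⁻¹ * ‖(s:ℂ) - z‖⁻¹)) ≤ ENNReal.ofReal ‖g s‖ * C := by
    intro s
    rw [lintegral_lintegral_swap (by fun_prop)]
    by_cases hs : M < |s|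
    · rw [hg s hs]; simp
    push Not at hs
    refine le_trans (le_of_eq ?_) (mul_le_mul_right (hb s hs) _)
    rw [← lintegral_const_mul]
    · refine lintegral_congr fun t => ?_
      rw [lintegral_const_mul _ (by fun_prop), lintegral_const_mul _ (by fun_prop)]
    · refine Measurable.mul (by fun_prop) ?_
      apply Measurable.lintegral_prod_right
      fun_prop
  refine (lintegral_mono e2).trans_lt ?_
  rw [lintegral_mul_const _ (by fun_prop)]
  exact ENNReal.mul_lt_top hint.norm.lintegral_lt_top hC

lemma norm_ge_im (t : ℝ) (z : ℂ) : z.im ≤ ‖(t:ℂ) - z‖ := by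
  have := Complex.abs_im_le_norm ((t:ℂ) - z)
  simp at this
  exact (le_abs_self _).trans this

lemma diff_cauchy (g : ℝ → ℂ) (hmeas : Measurable g) (hint : Integrable g) (z : ℂ)
    (hz : 0 < z.im) : DifferentiableAt ℂ (cauchyTransform g) z := by
  unfold cauchyTransform
  refine DifferentiableAt.const_mul ?_ _
  have hge : ∀ t : ℝ, ∀ w ∈ Metric.ball z (z.im / 2), z.im / 2 ≤ ‖(t:ℂ) - w‖ := by
    intro t w hw
    have h1 := Complex.abs_im_le_norm (w - z)
    rw [Metric.mem_ball, dist_eq_norm] at hw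
    have h2 := norm_ge_im t w
    have h3 := neg_abs_le (w - z).im
    simp only [Complex.sub_im] at h1 h3
    linarith
  have hp : 0 < z.im / 2 := by linarith
  refine (hasDerivAt_integral_of_dominated_loc_of_deriv_le (μ := volume)
    (F := fun w t => g t / ((t:ℂ) - w)) (F' := fun w t => g t / ((t:ℂ) - w) ^ 2)
    (bound := fun t => ‖g t‖ / (z.im / 2) ^ 2) (s := Metric.ball z (z.im / 2))
    (Metric.ball_mem_nhds z hp) ?_ ?_ ?_ ?_ ?_ ?_).2.differentiableAt
  · refine Filter.Eventually.of_forall fun w => ?_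
    exact Measurable.aestronglyMeasurable (by fun_prop)
  · refine Integrable.mono' (hint.norm.div_const (z.im / 2))
      (Measurable.aestronglyMeasurable (by fun_prop)) (Filter.Eventually.of_forall fun t => ?_)
    rw [norm_div]
    have := hge t z (Metric.mem_ball_self hp)
    gcongr
  · exact Measurable.aestronglyMeasurable (by fun_prop)
  · refine Filter.Eventually.of_forall fun t w hw => ?_
    rw [norm_div, norm_pow]
    have := hge t w hw
    gcongr
  · exact hint.norm.div_const _
  · refine Filter.Eventually.of_forall fun t w hw => ?_
    have hne : (t:ℂ) - w ≠ 0 := norm_pos_iff.1 (hp.trans_le (hge t w hw))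
    have := (((hasDerivAt_id w).const_sub (t:ℂ)).inv hne).const_mul (g t)
    simp only [div_eq_mul_inv, neg_neg, one_mul, id] at this ⊢
    exact this

/-- For compactly supported `g ∈ L log⁺ L(ℝ)` and any open square `Ω` in the upper
half-plane with one side on `ℝ`, the Cauchy transform `𝒞g` belongs to `A²(Ω)`. -/
theorem cauchyTransform_mem_bergman_of_square
    (g : ℝ → ℂ) (hmeas : Measurable g) (hsupp : HasCompactSupport g)
    (hLlogL : ∫⁻ t : ℝ, ENNReal.ofReal (‖g t‖ * (1 + logPlus ‖g t‖)) < ⊤)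
    (a l : ℝ) (hl : 0 < l) :
    MemA2 {z : ℂ | a < z.re ∧ z.re < a + l ∧ 0 < z.im ∧ z.im < l}
      (cauchyTransform g) := by
  have hint : Integrable g := by
    refine ⟨hmeas.aestronglyMeasurable, ?_⟩
    refine lt_of_le_of_lt (lintegral_mono fun t => ?_) hLlogL
    rw [← ofReal_norm_eq_enorm]
    refine ENNReal.ofReal_le_ofReal ?_
    have hp : 0 ≤ logPlus ‖g t‖ := Real.log_nonneg (le_max_right _ _)
    nlinarith [norm_nonneg (g t)]
  refine ⟨fun z hz => (diff_cauchy g hmeas hint z hz.2.2.1).differentiableWithinAt, ?_⟩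
  obtain ⟨M, hM⟩ := hsupp.isCompact.isBounded.exists_norm_le
  have hg : ∀ t, M < |t| → g t = 0 := by
    intro t ht
    by_contra h
    have := hM t (subset_tsupport g h)
    rw [Real.norm_eq_abs] at this
    linarith
  set Ω : Set ℂ := {z : ℂ | a < z.re ∧ z.re < a + l ∧ 0 < z.im ∧ z.im < l} with hΩd
  have hΩ : MeasurableSet Ω := by
    have e : Ω = {z : ℂ | a < z.re} ∩ ({z : ℂ | z.re < a + l} ∩
      ({z : ℂ | 0 < z.im} ∩ {z : ℂ | z.im < l})) := rfl
    rw [e]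
    refine (measurableSet_lt ?_ ?_).inter ((measurableSet_lt ?_ ?_).inter
      ((measurableSet_lt ?_ ?_).inter (measurableSet_lt ?_ ?_))) <;> fun_prop
  have key := sq_bound g hmeas hLlogL (M + |a| + 2 * l) M (by linarith [abs_nonneg a]) hg Ω hΩ
    (fun z hz => hz.2.2.1) (by
      rintro t ht z ⟨h1, h2, h3, h4⟩
      have h5 := norm_sub_le (t:ℂ) z
      have h6 := Complex.norm_le_abs_re_add_abs_im z
      rw [Complex.norm_real, Real.norm_eq_abs] at h5
      have h7 : |z.re| ≤ |a| + l :=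
        abs_le.2 ⟨by linarith [neg_abs_le a], by linarith [le_abs_self a]⟩
      rw [abs_of_pos h3] at h6
      linarith) hint
  have pt : ∀ z : ℂ, ENNReal.ofReal (‖cauchyTransform g z‖ ^ 2) ≤
      ‖(Complex.I * (Real.pi : ℂ))⁻¹‖ₑ ^ 2 *
      (∫⁻ t : ℝ, ENNReal.ofReal ‖g t‖ * ENNReal.ofReal ‖(t:ℂ) - z‖⁻¹) ^ 2 := by
    intro z
    rw [ENNReal.ofReal_pow (norm_nonneg _), ofReal_norm_eq_enorm, cauchyTransform, enorm_mul,
      mul_pow]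
    gcongr
    refine (enorm_integral_le_lintegral_enorm _).trans (le_of_eq ?_)
    refine lintegral_congr fun t => ?_
    rw [← ofReal_norm_eq_enorm, norm_div, div_eq_mul_inv, ENNReal.ofReal_mul (norm_nonneg _)]
  refine (lintegral_mono pt).trans_lt ?_
  rw [lintegral_const_mul]
  · exact ENNReal.mul_lt_top (ENNReal.pow_lt_top enorm_lt_top) key
  · refine Measurable.pow_const ?_ 2
    apply Measurable.lintegral_prod_right
    fun_prop

end
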